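/- Let n ≥ 2. (a) If B is a finite Blaschke product of degree n with B(1) = 1, then there exist real numbers a > 0, b ∈ ℝ, t_1 < t_2 < … < t_{n-1} and positive real numbers s_1, …, s_{n-1} such that the function g(w) = aw + b - ∑_{k=1}^{n-1} s_k/(w - t_k) satisfies g(T(z)) = T(B(z)) for every z ∈ 𝔻 with B(z) ≠ 1. (b) Conversely, for any a > 0, b ∈ ℝ, reals t_1 < t_2 < … < t_{n-1} and s_1, …, s_{n-1} > 0, setting g(w) = aw + b - ∑_{k=1}^{n-1} s_k/(w - t_k), the function B(z) := T⁻¹(g(T(z))) extends to a finite Blaschke product of degree n with B(1) = 1. -/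

import Mathlib

open Complex ComplexConjugate Finset

/-- The (inverse) Cayley transform `T(z) = i(1+z)/(1-z)`, mapping the unit disc onto
the upper half-plane. -/
noncomputable def T (z : ℂ) : ℂ := Complex.I * (1 + z) / (1 - z)

/-- The inverse of `T`, namely `T⁻¹(w) = (w - i)/(w + i)`. -/
noncomputable def Tinv (w : ℂ) : ℂ := (w - Complex.I) / (w + Complex.I)

/-- A finite Blaschke product with zeros `a k` and unimodular constant `c`. -/
noncomputable def blaschke {n : ℕ} (c : ℂ) (a : Fin n → ℂ) (z : ℂ) : ℂ :=
  c * ∏ k, (z - a k) / (1 - conj (a k) * z)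

lemma T_sub (z a : ℂ) (hz : 1 - z ≠ 0) (ha : 1 - a ≠ 0) :
    T z - T a = 2 * I * (z - a) / ((1 - z) * (1 - a)) := by
  unfold T; field_simp; ring

lemma one_sub_ne {z : ℂ} (hz : ‖z‖ < 1) : 1 - z ≠ 0 := by
  intro h
  have : z = 1 := (sub_eq_zero.mp h).symm
  simp [this] at hz

lemma T_sub_conj (z a : ℂ) (hz : 1 - z ≠ 0) (ha : 1 - conj a ≠ 0) :
    T z - conj (T a) = 2 * I * (1 - conj a * z) / ((1 - z) * (1 - conj a)) := by
  unfold T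
  simp only [map_div₀, map_mul, map_sub, map_add, map_one, conj_I]
  field_simp; ring

lemma factor_eq {z a : ℂ} (hz : ‖z‖ < 1) (ha : ‖a‖ < 1) :
    (z - a) / (1 - conj a * z) =
      (1 - a) / (1 - conj a) * ((T z - T a) / (T z - conj (T a))) := by
  have h1 := one_sub_ne hz
  have h2 := one_sub_ne ha
  have h3 : 1 - conj a ≠ 0 := one_sub_ne (by simpa using ha)
  have h4 : 1 - conj a * z ≠ 0 := one_sub_ne (by
    rw [norm_mul]
    have : ‖conj a‖ < 1 := by simpa using ha
    nlinarith [norm_nonneg z, norm_nonneg (conj a)])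
  rw [T_sub z a h1 h2, T_sub_conj z a h1 h3]
  have := I_ne_zero
  field_simp

lemma T_im_pos {z : ℂ} (hz : ‖z‖ < 1) : 0 < (T z).im := by
  have h1 := one_sub_ne hz
  have h3 : 1 - conj z ≠ 0 := one_sub_ne (by simpa using hz)
  have h := T_sub_conj z z h1 h3
  have e : (2 * I * (1 - conj z * z) / ((1 - z) * (1 - conj z))) =
      ((2 * (1 - normSq z) / normSq (1 - z) : ℝ) : ℂ) * I := by
    have hc : (1 - conj z) = conj (1 - z) := by simp
    rw [hc, mul_conj, mul_comm (conj z), mul_conj]; push_cast; ring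
  rw [e] at h
  have h5 := congrArg Complex.im h
  rw [im_ofReal_mul] at h5
  simp only [sub_im, conj_im, I_im] at h5
  have h6 : normSq z < 1 := by
    rw [normSq_eq_norm_sq]; nlinarith [norm_nonneg z]
  have h7 : 0 < normSq (1 - z) := normSq_pos.mpr h1
  have : 0 < 2 * (1 - normSq z) / normSq (1 - z) := by
    apply div_pos _ h7; linarith
  linarith

lemma add_I_ne {w : ℂ} (hw : 0 < w.im) : w + I ≠ 0 := by
  intro h
  have := congrArg Complex.im h
  simp at this; linarith

lemma Tinv_norm {w : ℂ} (hw : 0 < w.im) : ‖Tinv w‖ < 1 := by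
  unfold Tinv
  have h0 := add_I_ne hw
  rw [norm_div, div_lt_one (norm_pos_iff.mpr h0)]
  apply lt_of_pow_lt_pow_left₀ 2 (norm_nonneg _)
  rw [← normSq_eq_norm_sq, ← normSq_eq_norm_sq, normSq_apply, normSq_apply]
  simp; nlinarith

lemma T_Tinv {w : ℂ} (hw : 0 < w.im) : T (Tinv w) = w := by
  have h0 := add_I_ne hw
  have := I_ne_zero
  unfold T Tinv
  have e : 1 - (w - I) / (w + I) = 2 * I / (w + I) := by field_simp; ring
  rw [e]; field_simp; ring

lemma blaschke_one {n : ℕ} (c : ℂ) (a : Fin n → ℂ) :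
    blaschke c a 1 = c * ∏ k, (1 - a k) / (1 - conj (a k)) := by
  simp [blaschke]

lemma blaschke_eq {n : ℕ} (c : ℂ) (a : Fin n → ℂ) (ha : ∀ k, ‖a k‖ < 1)
    (h1 : blaschke c a 1 = 1) {z : ℂ} (hz : ‖z‖ < 1) :
    blaschke c a z = (∏ k, (T z - T (a k))) / ∏ k, (T z - conj (T (a k))) := by
  rw [blaschke_one] at h1
  unfold blaschke
  rw [prod_congr rfl (fun k _ => factor_eq hz (ha k)), prod_mul_distrib, ← mul_assoc, h1,
    one_mul, prod_div_distrib]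

open Polynomial in
/-- Hermite–Biehler data by induction. -/
lemma hb {ι : Type*} [DecidableEq ι] (α : ι → ℂ) (hα : ∀ k, 0 < (α k).im) (s : Finset ι) :
    ∃ P Q : ℝ[X], (∀ w : ℂ, ∏ k ∈ s, (w - α k) = aeval w P + I * aeval w Q) ∧
      (∀ w : ℂ, ∏ k ∈ s, (w - conj (α k)) = aeval w P - I * aeval w Q) ∧
      P.natDegree ≤ s.card ∧ P.coeff s.card = 1 ∧ Q.degree < s.card ∧
      Q.coeff (s.card - 1) = - ∑ k ∈ s, (α k).im ∧
      (∀ x : ℝ, 0 < P.eval x ^ 2 + Q.eval x ^ 2) ∧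
      (∀ x : ℝ, 0 ≤ P.eval x * Q.derivative.eval x - P.derivative.eval x * Q.eval x) ∧
      (s.Nonempty → ∀ x : ℝ,
        0 < P.eval x * Q.derivative.eval x - P.derivative.eval x * Q.eval x) := by
  induction s using Finset.induction_on with
  | empty => exact ⟨1, 0, by simp⟩
  | insert i s hi ih =>
    obtain ⟨P, Q, h1, h2, h3, h4, h5, h6, h7, h8, -⟩ := ih
    set x := (α i).re with hx
    set y := (α i).im with hy
    have hy0 : 0 < y := hα i
    have ea : α i = x + I * y := by rw [mul_comm]; exact (re_add_im _).symm
    have W : ∀ u : ℝ, 0 < ((X - C x) * P + C y * Q).eval u *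
          ((X - C x) * Q - C y * P).derivative.eval u -
          ((X - C x) * P + C y * Q).derivative.eval u * ((X - C x) * Q - C y * P).eval u := by
      intro u
      have e : ((X - C x) * P + C y * Q).eval u *
          ((X - C x) * Q - C y * P).derivative.eval u -
          ((X - C x) * P + C y * Q).derivative.eval u * ((X - C x) * Q - C y * P).eval u
          = y * (P.eval u ^ 2 + Q.eval u ^ 2) + ((u - x) ^ 2 + y ^ 2) *
            (P.eval u * Q.derivative.eval u - P.derivative.eval u * Q.eval u) := by
        simp; ring
      rw [e]
      have := mul_pos hy0 (h7 u)
      have := mul_nonneg (by positivity : 0 ≤ (u - x) ^ 2 + y ^ 2) (h8 u)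
      linarith
    refine ⟨(X - C x) * P + C y * Q, (X - C x) * Q - C y * P, ?_, ?_, ?_, ?_, ?_, ?_, ?_,
      fun u => (W u).le, fun _ => W⟩
    · intro w
      rw [prod_insert hi, h1, ea]
      simp
      linear_combination (- (y : ℂ) * aeval w Q) * I_mul_I
    · intro w
      rw [prod_insert hi, h2, ea]
      simp
      linear_combination (- (y : ℂ) * aeval w Q) * I_mul_I
    · rw [card_insert_of_notMem hi]
      have hQ : Q.natDegree ≤ s.card := natDegree_le_of_degree_le h5.le
      refine natDegree_le_iff_coeff_eq_zero.mpr fun m hm => ?_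
      obtain ⟨m, rfl⟩ : ∃ k, m = k + 1 := ⟨m - 1, by omega⟩
      have a1 : P.coeff (m + 1) = 0 := coeff_eq_zero_of_natDegree_lt (by omega)
      have a2 : P.coeff m = 0 := coeff_eq_zero_of_natDegree_lt (by omega)
      have a3 : Q.coeff (m + 1) = 0 := coeff_eq_zero_of_natDegree_lt (by omega)
      simp [sub_mul, coeff_X_mul, a1, a2, a3]
    · rw [card_insert_of_notMem hi]
      have a1 : P.coeff (s.card + 1) = 0 := coeff_eq_zero_of_natDegree_lt (by omega)
      have a2 : Q.coeff (s.card + 1) = 0 :=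
        coeff_eq_zero_of_degree_lt (h5.trans (by exact_mod_cast Nat.lt_succ_self _))
      simp [sub_mul, coeff_X_mul, a1, a2, h4]
    · rw [card_insert_of_notMem hi]
      rw [degree_lt_iff_coeff_zero]
      intro m hm
      obtain ⟨m, rfl⟩ : ∃ k, m = k + 1 := ⟨m - 1, by omega⟩
      have a1 : P.coeff (m + 1) = 0 := coeff_eq_zero_of_natDegree_lt (by omega)
      rw [degree_lt_iff_coeff_zero] at h5
      simp [sub_mul, coeff_X_mul, a1, h5 m (by omega), h5 (m+1) (by omega)]
    · rw [card_insert_of_notMem hi, sum_insert hi]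
      rw [degree_lt_iff_coeff_zero] at h5
      rcases Nat.eq_zero_or_pos s.card with h0 | h0
      · have hs : s = ∅ := card_eq_zero.mp h0
        subst hs
        have := h5 0 (by simp)
        simp at h4
        simp [sub_mul, this, h4, hy]
      · obtain ⟨m, hm⟩ : ∃ k, s.card = k + 1 := ⟨s.card - 1, by omega⟩
        have := h5 (m + 1) (by omega)
        rw [hm] at h4 h6 ⊢
        simp at h6
        simp [sub_mul, coeff_X_mul, this, h4, h6, hy]; ring
    · intro u
      have e : ((X - C x) * P + C y * Q).eval u ^ 2 + ((X - C x) * Q - C y * P).eval u ^ 2 =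
        ((u - x) ^ 2 + y ^ 2) * (P.eval u ^ 2 + Q.eval u ^ 2) := by simp; ring
      rw [e]
      have := h7 u
      positivity

lemma prod_lt_aux {ι : Type*} (s : Finset ι) (hs : s.Nonempty) (f g : ι → ℝ)
    (hf : ∀ k ∈ s, 0 ≤ f k) (hfg : ∀ k ∈ s, f k < g k) : ∏ k ∈ s, f k < ∏ k ∈ s, g k := by
  have hg : 0 < ∏ k ∈ s, g k := prod_pos fun k hk => (hf k hk).trans_lt (hfg k hk)
  by_cases h : ∃ k ∈ s, f k = 0
  · obtain ⟨k, hk, h0⟩ := h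
    rwa [prod_eq_zero hk h0]
  · push Not at h
    obtain ⟨k, hk⟩ := hs
    exact prod_lt_prod (fun k hk => lt_of_le_of_ne (hf k hk) (h k hk).symm)
      (fun k hk => (hfg k hk).le) ⟨k, hk, hfg k hk⟩

lemma norm_sub_lt {w α : ℂ} (hα : 0 < α.im) (hw : 0 < w.im) : ‖w - α‖ < ‖w - conj α‖ := by
  apply lt_of_pow_lt_pow_left₀ 2 (norm_nonneg _)
  rw [← normSq_eq_norm_sq, ← normSq_eq_norm_sq, normSq_apply, normSq_apply]
  simp; nlinarith [mul_pos hα hw]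

lemma norm_sub_lt' {w α : ℂ} (hα : 0 < α.im) (hw : w.im < 0) : ‖w - conj α‖ < ‖w - α‖ := by
  apply lt_of_pow_lt_pow_left₀ 2 (norm_nonneg _)
  rw [← normSq_eq_norm_sq, ← normSq_eq_norm_sq, normSq_apply, normSq_apply]
  simp; nlinarith [mul_pos hα (neg_pos.mpr hw)]

lemma im_eq_zero_of_prod {ι : Type*} (s : Finset ι) (hs : s.Nonempty) (α : ι → ℂ)
    (hα : ∀ k, 0 < (α k).im) (w : ℂ) (h : ∏ k ∈ s, (w - α k) = ∏ k ∈ s, (w - conj (α k))) :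
    w.im = 0 := by
  have h' := congrArg norm h
  rw [norm_prod, norm_prod] at h'
  rcases lt_trichotomy w.im 0 with hw | hw | hw
  · exact absurd h' (prod_lt_aux s hs _ _ (fun _ _ => norm_nonneg _)
      (fun k _ => norm_sub_lt' (hα k) hw)).ne'
  · exact hw
  · exact absurd h' (prod_lt_aux s hs _ _ (fun _ _ => norm_nonneg _)
      (fun k _ => norm_sub_lt (hα k) hw)).ne

open Polynomial in
lemma pf (m : ℕ) (P Q : ℝ[X]) (hP : P.natDegree ≤ m + 1) (hP1 : P.coeff (m + 1) = 1)
    (hQ : Q.natDegree = m) (hQl : Q.leadingCoeff < 0) (hs : Q.Splits)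
    (W : ∀ x : ℝ, 0 < P.eval x * Q.derivative.eval x - P.derivative.eval x * Q.eval x) :
    ∃ (a b : ℝ) (t s : Fin m → ℝ) (l : ℝ), 0 < a ∧ StrictMono t ∧ (∀ k, 0 < s k) ∧
      Q = C l * ∏ k, (X - C (t k)) ∧
      -P = (C a * X + C b) * Q - ∑ k, C (s k) * (C l * ∏ j ∈ univ.erase k, (X - C (t j))) := by
  set l := Q.leadingCoeff with hl
  have hQ0 : Q ≠ 0 := by
    intro h; simp [hl, h] at hQl
  have hnd : Q.roots.Nodup := by
    rw [Multiset.nodup_iff_count_le_one]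
    intro x
    rw [count_roots]
    by_contra hx
    push Not at hx
    obtain ⟨g1, g2⟩ := (one_lt_rootMultiplicity_iff_isRoot hQ0).mp hx
    rw [IsRoot] at g1 g2
    have := W x
    rw [g1, g2] at this
    simp at this
  have hcard : Q.roots.toFinset.card = m := by
    rw [Multiset.toFinset_card_of_nodup hnd, ← hs.natDegree_eq_card_roots, hQ]
  set t : Fin m → ℝ := fun k => Q.roots.toFinset.orderEmbOfFin hcard k with ht
  have htm : StrictMono t := (Q.roots.toFinset.orderEmbOfFin hcard).strictMono
  have hQt : Q = C l * ∏ k, (X - C (t k)) := by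
    have e : ∏ k, (X - C (t k)) = ∏ r ∈ Q.roots.toFinset, (X - C r) := by
      rw [← Finset.map_orderEmbOfFin_univ Q.roots.toFinset hcard, Finset.prod_map]
      rfl
    conv_lhs => rw [hs.eq_prod_roots]
    rw [e, Finset.prod, Multiset.toFinset_val, hnd.dedup]
  have hroot : ∀ k, Q.eval (t k) = 0 := fun k => by
    rw [hQt, eval_mul, eval_prod, prod_eq_zero (mem_univ k) (by simp), mul_zero]
  have hder : ∀ k, Q.derivative.eval (t k) = l * ∏ j ∈ univ.erase k, (t k - t j) := fun k => by
    have : Q = (X - C (t k)) * (C l * ∏ j ∈ univ.erase k, (X - C (t j))) := by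
      conv_lhs => rw [hQt, ← mul_prod_erase _ _ (mem_univ k)]
      ring
    conv_lhs => rw [this]
    simp [eval_prod]
  have hPQ : ∀ k, 0 < P.eval (t k) * Q.derivative.eval (t k) := fun k => by
    have := W (t k); rwa [hroot, mul_zero, sub_zero] at this
  set s : Fin m → ℝ := fun k => P.eval (t k) / Q.derivative.eval (t k) with hsdef
  have hspos : ∀ k, 0 < s k := fun k => by
    have := hPQ k
    rcases pos_and_pos_or_neg_and_neg_of_mul_pos this with h | h
    · exact div_pos h.1 h.2
    · exact div_pos_of_neg_of_neg h.1 h.2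
  set S : ℝ[X] := ∑ k, C (s k) * (C l * ∏ j ∈ univ.erase k, (X - C (t j))) with hS
  have hSdeg : S.degree < m := by
    rw [degree_lt_iff_coeff_zero]
    intro d hd
    rw [hS, finsetSum_coeff]
    refine sum_eq_zero fun k _ => ?_
    rw [coeff_C_mul, coeff_C_mul, coeff_eq_zero_of_natDegree_lt, mul_zero, mul_zero]
    rw [natDegree_prod_of_monic _ _ fun j _ => monic_X_sub_C _]
    simp
    have := k.2
    omega
  have hSev : ∀ k, S.eval (t k) = P.eval (t k) := fun k => by
    rw [hS, eval_finsetSum, sum_eq_single k]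
    · have h0 : Q.derivative.eval (t k) ≠ 0 := right_ne_zero_of_mul (hPQ k).ne'
      rw [eval_mul, eval_mul, eval_C, eval_C, eval_prod]
      simp only [eval_sub, eval_X, eval_C]
      rw [← hder k, hsdef]; field_simp
    · intro j _ hj
      rw [eval_mul, eval_mul, eval_prod, prod_eq_zero (i := k) (by simp [hj.symm]) (by simp)]
      simp
    · simp
  have hdvd : (∏ k, (X - C (t k))) ∣ S - P := by
    refine Finset.prod_dvd_of_coprime ?_ ?_
    · intro i _ j _ hij
      exact pairwise_coprime_X_sub_C htm.injective hij
    · intro k _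
      rw [dvd_iff_isRoot, IsRoot, eval_sub, hSev, sub_self]
  obtain ⟨L0, hL0⟩ := hdvd
  obtain ⟨L, hL⟩ : ∃ L, S - P = L * Q := ⟨C l⁻¹ * L0, by
    rw [hL0]; conv_rhs => rw [hQt]
    have : C l⁻¹ * C l = (1 : ℝ[X]) := by rw [← C_mul, inv_mul_cancel₀ hQl.ne, C_1]
    linear_combination (-L0 * ∏ k, (X - C (t k))) * this⟩
  have hPd : P.natDegree = m + 1 := le_antisymm hP (le_natDegree_of_ne_zero (by simp [hP1]))
  have hSP : (S - P).natDegree = m + 1 := by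
    refine le_antisymm ?_ (le_natDegree_of_ne_zero ?_)
    · refine (natDegree_sub_le _ _).trans (max_le ?_ hP)
      exact natDegree_le_of_degree_le (hSdeg.le.trans (by exact_mod_cast Nat.le_succ _))
    · rw [coeff_sub, hP1, coeff_eq_zero_of_degree_lt (hSdeg.trans (by exact_mod_cast Nat.lt_succ_self _))]
      norm_num
  have hSPl : (S - P).leadingCoeff = -1 := by
    rw [leadingCoeff, hSP, coeff_sub, hP1,
      coeff_eq_zero_of_degree_lt (hSdeg.trans (by exact_mod_cast Nat.lt_succ_self _))]
    norm_num
  have hLne : L ≠ 0 := by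
    rintro rfl
    rw [hL] at hSPl; simp at hSPl
  have hLd : L.natDegree = 1 := by
    rw [hL, natDegree_mul hLne hQ0, hQ] at hSP; omega
  have hLl : L.leadingCoeff * l = -1 := by
    rw [← hSPl, hL, leadingCoeff_mul]
  have hLe : L = C (L.coeff 1) * X + C (L.coeff 0) := eq_X_add_C_of_natDegree_le_one hLd.le
  refine ⟨L.coeff 1, L.coeff 0, t, s, l, ?_, htm, hspos, hQt, ?_⟩
  · rw [leadingCoeff, hLd] at hLl
    nlinarith
  · rw [← hLe]
    linear_combination hL

/-- Part (a). -/
lemma part_a (m : ℕ) (aa : Fin (m + 1) → ℂ) (c : ℂ) (ha : ∀ k, ‖aa k‖ < 1)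
    (hB : blaschke c aa 1 = 1) :
      ∃ (a b : ℝ) (t s : Fin m → ℝ), 0 < a ∧ StrictMono t ∧ (∀ k, 0 < s k) ∧
        ∀ z : ℂ, ‖z‖ < 1 →
          ((a : ℂ) * T z + (b : ℂ) - ∑ k, (s k : ℂ) / (T z - (t k : ℂ)))
            = T (blaschke c aa z) := by
  have hα : ∀ k, 0 < (T (aa k)).im := fun k => T_im_pos (ha k)
  obtain ⟨P, Q, h1, h2, h3, h4, h5, h6, -, -, h9⟩ := hb (fun k => T (aa k)) hα univ
  have W := h9 univ_nonempty
  simp only [card_univ, Fintype.card_fin] at h3 h4 h5 h6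
  have hneg : Q.coeff m < 0 := by
    rw [Nat.add_sub_cancel] at h6
    rw [h6, neg_lt_zero]
    exact sum_pos (fun k _ => hα k) univ_nonempty
  have hQ : Q.natDegree = m := by
    refine le_antisymm ?_ (Polynomial.le_natDegree_of_ne_zero hneg.ne)
    have := Polynomial.natDegree_lt_iff_degree_lt (n := m + 1) (p := Q)
      (by rintro rfl; simp at hneg)
    have := this.mpr (by exact_mod_cast h5)
    omega
  have hreal : ∀ w : ℂ, Polynomial.aeval w Q = 0 → w.im = 0 := by
    intro w hw
    refine im_eq_zero_of_prod univ univ_nonempty _ hα w ?_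
    rw [h1, h2, hw]; simp
  have hs : Q.Splits := by
    refine Polynomial.Splits.of_splits_map (algebraMap ℝ ℂ) (IsAlgClosed.splits _) ?_
    intro w hw
    have := hreal w (by
      have := Polynomial.isRoot_of_mem_roots hw
      rwa [Polynomial.IsRoot, Polynomial.eval_map_algebraMap] at this)
    exact ⟨w.re, by apply Complex.ext <;> simp [this]⟩
  obtain ⟨a, b, t, s, l, ha0, ht, hs0, e1, e2⟩ := pf m P Q h3 h4 hQ
    (by rwa [Polynomial.leadingCoeff, hQ]) hs W
  refine ⟨a, b, t, s, ha0, ht, hs0, fun z hz => ?_⟩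
  rw [blaschke_eq c aa ha hB hz, h1, h2]
  have hw := T_im_pos hz
  set w := T z
  have hQw : Polynomial.aeval w Q ≠ 0 := fun h => hw.ne' (hreal w h)
  have hden : Polynomial.aeval w P - I * Polynomial.aeval w Q ≠ 0 := by
    rw [← h2 w, prod_ne_zero_iff]
    intro k _ h
    have := congrArg Complex.im h
    simp at this
    linarith [hα k]
  have htw : ∀ k, w - (t k : ℂ) ≠ 0 := fun k h => by
    have := congrArg Complex.im h
    simp at this; linarith
  have e3 := congrArg (Polynomial.aeval w) e1
  have e4 := congrArg (Polynomial.aeval w) e2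
  simp [map_prod, map_sum] at e3 e4
  have e5 : ∑ k, (s k : ℂ) * (l * ∏ j ∈ univ.erase k, (w - (t j : ℂ))) =
      (∑ k, (s k : ℂ) / (w - (t k : ℂ))) * Polynomial.aeval w Q := by
    rw [sum_mul]
    refine sum_congr rfl fun k _ => ?_
    rw [e3, ← mul_prod_erase univ (fun j => w - (t j : ℂ)) (mem_univ k)]
    field_simp [htw k]
  rw [e5] at e4
  have hT : T ((Polynomial.aeval w P + I * Polynomial.aeval w Q) /
      (Polynomial.aeval w P - I * Polynomial.aeval w Q)) =
      - Polynomial.aeval w P / Polynomial.aeval w Q := by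
    unfold T
    set p := Polynomial.aeval w P
    set q := Polynomial.aeval w Q
    have h1' : 1 - (p + I * q) / (p - I * q) = -2 * I * q / (p - I * q) := by
      field_simp; ring
    have := I_ne_zero
    rw [h1']; field_simp; ring
  rw [hT, e4]
  field_simp

lemma exists_fin_map {A : Type*} (n : ℕ) (s : Multiset A) (h : Multiset.card s = n) :
    ∃ f : Fin n → A, s = (univ : Finset (Fin n)).val.map f := by
  subst h
  induction s using Quotient.inductionOn with
  | _ l => exact ⟨fun i => l.get i, by
      change (l : Multiset A) = (univ : Finset (Fin l.length)).val.map l.get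
      rw [Fin.univ_val_map, List.ofFn_get]⟩

/-- The imaginary part of `g`. -/
lemma g_im {m : ℕ} (a b : ℝ) (t s : Fin m → ℝ) (w : ℂ) :
    ((a : ℂ) * w + (b : ℂ) - ∑ k, (s k : ℂ) / (w - (t k : ℂ))).im =
      w.im * (a + ∑ k, s k / normSq (w - t k)) := by
  simp [div_im, mul_add, mul_sum]
  congr 1
  · ring
  · refine sum_congr rfl fun k _ => ?_
    ring

open Polynomial in
lemma part_b (m : ℕ) (a b : ℝ) (t s : Fin m → ℝ) (ha : 0 < a) (ht : StrictMono t)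
    (hs : ∀ k, 0 < s k) :
      ∃ (aa : Fin (m + 1) → ℂ) (c : ℂ), (∀ k, ‖aa k‖ < 1) ∧ ‖c‖ = 1 ∧
        blaschke c aa 1 = 1 ∧
        ∀ z : ℂ, ‖z‖ < 1 →
          blaschke c aa z
            = Tinv ((a : ℂ) * T z + (b : ℂ) - ∑ k, (s k : ℂ) / (T z - (t k : ℂ))) := by
  set N : ℂ[X] := ∏ j, (X - C (t j : ℂ)) with hN
  set S : ℂ[X] := ∑ k, C (s k : ℂ) * ∏ j ∈ univ.erase k, (X - C (t j : ℂ)) with hS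
  set p : ℂ[X] := (C (a : ℂ) * X + C ((b : ℂ) - I)) * N - S with hp
  have hane : (a : ℂ) ≠ 0 := by exact_mod_cast ha.ne'
  have hNm : N.Monic := monic_prod_of_monic _ _ fun j _ => monic_X_sub_C _
  have hNd : N.natDegree = m := by
    rw [hN, natDegree_prod_of_monic _ _ fun j _ => monic_X_sub_C _]; simp
  have hSdeg : S.degree < (m + 1 : ℕ) := by
    rw [degree_lt_iff_coeff_zero]
    intro d hd
    rw [hS, finsetSum_coeff]
    refine sum_eq_zero fun k _ => ?_
    rw [coeff_C_mul, coeff_eq_zero_of_natDegree_lt, mul_zero]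
    rw [natDegree_prod_of_monic _ _ fun j _ => monic_X_sub_C _]
    simp
    have := k.2
    omega
  have hld : ((C (a : ℂ) * X + C ((b : ℂ) - I)) * N).degree = ((m + 1 : ℕ) : WithBot ℕ) := by
    rw [degree_mul, degree_linear hane, degree_eq_natDegree hNm.ne_zero, hNd]
    push_cast; ring
  have hpd : p.degree = ((m + 1 : ℕ) : WithBot ℕ) := by
    rw [hp, degree_sub_eq_left_of_degree_lt (by rwa [hld]), hld]
  have hpl : p.leadingCoeff = a := by
    rw [hp, leadingCoeff_sub_of_degree_lt (by rwa [hld]), leadingCoeff_mul,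
      leadingCoeff_linear hane, hNm.leadingCoeff, mul_one]
  have hspl : p.Splits := IsAlgClosed.splits p
  obtain ⟨α, hα⟩ := exists_fin_map (m + 1) p.roots (by
    rw [← hspl.natDegree_eq_card_roots, natDegree_eq_of_degree_eq_some hpd])
  have hpev : ∀ w : ℂ, p.eval w = a * ∏ k, (w - α k) := by
    intro w
    rw [hspl.eval_eq_prod_roots, hpl, hα, Multiset.map_map]; rfl
  have hpev2 : ∀ w : ℂ, p.eval w = (a * w + (b - I)) * ∏ j, (w - (t j : ℂ)) -
      ∑ k, (s k : ℂ) * ∏ j ∈ univ.erase k, (w - (t j : ℂ)) := by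
    intro w
    simp [hp, hN, hS, eval_prod, eval_finsetSum]
  have hsum : ∀ w : ℂ, (∀ k, w - (t k : ℂ) ≠ 0) →
      ∑ k, (s k : ℂ) * ∏ j ∈ univ.erase k, (w - (t j : ℂ)) =
      (∑ k, (s k : ℂ) / (w - (t k : ℂ))) * ∏ j, (w - (t j : ℂ)) := by
    intro w hw
    rw [sum_mul]
    refine sum_congr rfl fun k _ => ?_
    rw [← mul_prod_erase univ (fun j => w - (t j : ℂ)) (mem_univ k)]
    field_simp [hw k]
  have hαim : ∀ k, 0 < (α k).im := by
    intro i
    have h0 : p.eval (α i) = 0 := by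
      rw [hpev, prod_eq_zero (mem_univ i) (sub_self _), mul_zero]
    rw [hpev2] at h0
    by_cases hw : ∀ k, α i - (t k : ℂ) ≠ 0
    · rw [hsum _ hw] at h0
      have hne : ∏ j, (α i - (t j : ℂ)) ≠ 0 := prod_ne_zero_iff.mpr fun j _ => hw j
      have hg : (a : ℂ) * α i + (b : ℂ) - ∑ k, (s k : ℂ) / (α i - (t k : ℂ)) = I := by
        apply mul_right_cancel₀ hne
        linear_combination h0
      have him := congrArg Complex.im hg
      rw [g_im, I_im] at him
      have hpos : 0 < a + ∑ k, s k / normSq (α i - t k) :=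
        add_pos_of_pos_of_nonneg ha (sum_nonneg fun k _ =>
          div_nonneg (hs k).le (normSq_nonneg _))
      by_contra hneg
      nlinarith
    · push Not at hw
      obtain ⟨k, hk⟩ := hw
      exfalso
      rw [prod_eq_zero (mem_univ k) hk, mul_zero, zero_sub, neg_eq_zero,
        sum_eq_single k] at h0
      · rw [mul_eq_zero, prod_eq_zero_iff] at h0
        rcases h0 with h0 | ⟨j, hj, h0⟩
        · exact (hs k).ne' (by exact_mod_cast h0)
        · have : t k = t j := by
            have : (t k : ℂ) = t j := by linear_combination h0 - hk
            exact_mod_cast this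
          exact (mem_erase.mp hj).1 (ht.injective this).symm
      · intro j _ hj
        rw [prod_eq_zero (i := k) (by simp [hj.symm]) hk, mul_zero]
      · simp
  have hn1 : ∀ k, ‖Tinv (α k)‖ < 1 := fun k => Tinv_norm (hαim k)
  have hA : ∀ k, 1 - Tinv (α k) ≠ 0 := fun k => one_sub_ne (hn1 k)
  have hA' : ∀ k, 1 - conj (Tinv (α k)) ≠ 0 := fun k => one_sub_ne (by simpa using hn1 k)
  have hB : blaschke (∏ k, (1 - conj (Tinv (α k))) / (1 - Tinv (α k)))
      (fun k => Tinv (α k)) 1 = 1 := by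
    rw [blaschke_one, ← prod_mul_distrib]
    refine prod_eq_one fun k _ => ?_
    have := hA k
    have := hA' k
    field_simp
  refine ⟨fun k => Tinv (α k), ∏ k, (1 - conj (Tinv (α k))) / (1 - Tinv (α k)), hn1, ?_, hB, ?_⟩
  · rw [norm_prod]
    refine prod_eq_one fun k _ => ?_
    have : 1 - conj (Tinv (α k)) = conj (1 - Tinv (α k)) := by simp
    rw [norm_div, this, RCLike.norm_conj, div_self (norm_ne_zero_iff.mpr (hA k))]
  · intro z hz
    rw [blaschke_eq _ _ hn1 hB hz]
    simp only [fun k => T_Tinv (hαim k)]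
    have hw := T_im_pos hz
    set w := T z
    have htw : ∀ k, w - (t k : ℂ) ≠ 0 := fun k h => by
      have := congrArg Complex.im h
      simp at this; linarith
    have hne : ∏ j, (w - (t j : ℂ)) ≠ 0 := prod_ne_zero_iff.mpr fun j _ => htw j
    have e1 := hpev w
    rw [hpev2, hsum w htw] at e1
    have e2 := congrArg conj ((hpev2 (conj w)).symm.trans (hpev (conj w)))
    simp only [map_sub, map_mul, map_add, map_prod, map_sum, conj_conj, conj_ofReal, conj_I] at e2
    rw [hsum w htw] at e2
    unfold Tinv
    set g := (a : ℂ) * w + (b : ℂ) - ∑ k, (s k : ℂ) / (w - (t k : ℂ))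
    rw [← mul_div_mul_left (∏ k, (w - α k)) _ hane, ← e1, ← e2,
      ← mul_div_mul_right (g - I) (g + I) hne]
    congr 1 <;> ring

/-- **Lemma 2.** (a) Every finite Blaschke product `B` of degree `n` with `B(1) = 1`
is transformed by the Cayley transform into a rational function
`g(w) = a·w + b - ∑ s k / (w - t k)` with `a > 0`, `b ∈ ℝ`, ordered real poles
`t 1 < … < t (n-1)` and positive residues `s k`; (b) conversely every such `g` arises
from a finite Blaschke product of degree `n` with `B(1) = 1`. -/
theorem blaschke_iff_affine_partial_fractions (n : ℕ) (hn : 2 ≤ n) :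
    (∀ (aa : Fin n → ℂ) (c : ℂ), (∀ k, ‖aa k‖ < 1) → ‖c‖ = 1 →
      blaschke c aa 1 = 1 →
      ∃ (a b : ℝ) (t s : Fin (n - 1) → ℝ), 0 < a ∧ StrictMono t ∧ (∀ k, 0 < s k) ∧
        ∀ z : ℂ, ‖z‖ < 1 → blaschke c aa z ≠ 1 →
          ((a : ℂ) * T z + (b : ℂ) - ∑ k, (s k : ℂ) / (T z - (t k : ℂ)))
            = T (blaschke c aa z))
    ∧
    (∀ (a b : ℝ) (t s : Fin (n - 1) → ℝ), 0 < a → StrictMono t → (∀ k, 0 < s k) →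
      ∃ (aa : Fin n → ℂ) (c : ℂ), (∀ k, ‖aa k‖ < 1) ∧ ‖c‖ = 1 ∧
        blaschke c aa 1 = 1 ∧
        ∀ z : ℂ, ‖z‖ < 1 →
          blaschke c aa z
            = Tinv ((a : ℂ) * T z + (b : ℂ) - ∑ k, (s k : ℂ) / (T z - (t k : ℂ)))) := by
  obtain ⟨m, rfl⟩ : ∃ m, n = m + 1 := ⟨n - 1, by omega⟩
  refine ⟨fun aa c ha _ hB => ?_, fun a b t s ha ht hs => part_b m a b t s ha ht hs⟩
  obtain ⟨a, b, t, s, h1, h2, h3, h4⟩ := part_a m aa c ha hB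
  exact ⟨a, b, t, s, h1, h2, h3, fun z hz _ => h4 z hz⟩
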